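/- Let ε = 1 and let d be a nonzero integer (positive or negative) with d ∣ pD. For every prime l dividing D with l ∣ d, one has C′_d(ℚ_l) ≠ ∅ if and only if (1 − (−pdD·l⁻²/l))(1 − (−qdD·l⁻²/l)) = 0, i.e. the Legendre symbol of −pdD/l² modulo l equals 1 or the Legendre symbol of −qdD/l² modulo l equals 1 (note l² ∣ dD since l divides both d and D exactly once). -/

import Mathlib

/-- `CdPoints K m p q D d` says the curve `C_d` (with ε = 1), given by the homogeneous
equation `d w² = d² u⁴ - 2(p+q)D d u² z² + 4^m D² z⁴`, has a point over `K`. -/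
def CdPoints (K : Type) [Field K] (m : ℕ) (p q D d : ℤ) : Prop :=
  ∃ u z w : K, ¬(u = 0 ∧ z = 0) ∧
    (d : K) * w ^ 2 =
      (d : K) ^ 2 * u ^ 4 - 2 * ((p : K) + (q : K)) * (D : K) * (d : K) * u ^ 2 * z ^ 2
        + (4 : K) ^ m * (D : K) ^ 2 * z ^ 4

/-- `Cd'Points K p q D d` says the curve `C′_d` (with ε = 1), given by the homogeneous
equation `d w² = d² u⁴ + (p+q)D d u² z² + pq D² z⁴`, has a point over `K`. -/
def Cd'Points (K : Type) [Field K] (p q D d : ℤ) : Prop :=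
  ∃ u z w : K, ¬(u = 0 ∧ z = 0) ∧
    (d : K) * w ^ 2 =
      (d : K) ^ 2 * u ^ 4 + ((p : K) + (q : K)) * (D : K) * (d : K) * u ^ 2 * z ^ 2
        + (p : K) * (q : K) * (D : K) ^ 2 * z ^ 4

open Polynomial

theorem norm_intCast_eq_one_of_zmod_ne_zero {l : ℕ} [Fact l.Prime] {c : ℤ}
    (hc : (c : ZMod l) ≠ 0) : ‖(c : ℚ_[l])‖ = 1 := by
  refine (Padic.norm_int_le_one c).eq_of_not_lt fun hlt => hc ?_
  rwa [Padic.norm_intCast_lt_one_iff, ← ZMod.intCast_zmod_eq_zero_iff_dvd] at hlt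

theorem exists_sq_eq_intCast_of_legendreSym {l : ℕ} [Fact l.Prime] (hl2 : l ≠ 2) {a : ℤ}
    (ha : legendreSym l a = 1) : ∃ s : ℚ_[l], s ^ 2 = a := by
  have ha0 : (a : ZMod l) ≠ 0 := fun h => by
    rw [(legendreSym.eq_zero_iff l a).2 h] at ha
    exact zero_ne_one ha
  obtain ⟨b, hb⟩ := (legendreSym.eq_one_iff l ha0).1 ha
  obtain ⟨b, rfl⟩ := ZMod.intCast_surjective b
  have hdvd : (l : ℤ) ∣ b ^ 2 - a := by
    rw [← ZMod.intCast_zmod_eq_zero_iff_dvd]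
    push_cast
    rw [hb]
    ring
  have hb0 : ((2 * b : ℤ) : ZMod l) ≠ 0 := by
    push_cast
    refine mul_ne_zero (fun h => hl2 ?_) fun h => ha0 (by simp [hb, h])
    exact (Nat.prime_dvd_prime_iff_eq Fact.out Nat.prime_two).1
      ((ZMod.natCast_eq_zero_iff 2 l).1 (mod_cast h))
  have hF : (X ^ 2 - C (a : ℤ_[l])).derivative.aeval (b : ℤ_[l]) = ((2 * b : ℤ) : ℤ_[l]) := by
    simp [one_add_one_eq_two]
  have hF' : (X ^ 2 - C (a : ℤ_[l])).aeval (b : ℤ_[l]) = ((b ^ 2 - a : ℤ) : ℤ_[l]) := by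
    simp
  have hnorm : ‖(X ^ 2 - C (a : ℤ_[l])).aeval (b : ℤ_[l])‖ <
      ‖(X ^ 2 - C (a : ℤ_[l])).derivative.aeval (b : ℤ_[l])‖ ^ 2 := by
    rw [hF, hF', PadicInt.norm_intCast_eq_padic_norm (2 * b),
      norm_intCast_eq_one_of_zmod_ne_zero hb0, one_pow]
    exact (PadicInt.norm_int_lt_one_iff_dvd _).2 hdvd
  obtain ⟨z, hz, -⟩ := hensels_lemma hnorm
  refine ⟨z, ?_⟩
  have : z ^ 2 = (a : ℤ_[l]) := by simpa [sub_eq_zero] using hz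
  exact_mod_cast congrArg ((↑) : ℤ_[l] → ℚ_[l]) this

theorem norm_binary_form {l : ℕ} [Fact l.Prime] {A B : ℤ} (hA : (A : ZMod l) ≠ 0)
    (hB : (B : ZMod l) ≠ 0) (h : ¬ IsSquare ((-(A * B) : ℤ) : ZMod l)) (u z : ℚ_[l]) :
    ‖A * u ^ 2 + B * z ^ 2‖ = max ‖u‖ ‖z‖ ^ 2 := by
  by_cases huz : ‖u‖ = ‖z‖
  · rw [huz, max_self]
    rcases eq_or_ne z 0 with rfl | hz
    · simp [norm_eq_zero.1 (huz.trans norm_zero)]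
    have hz' := norm_ne_zero_iff.2 hz
    have ht : ‖u / z‖ = 1 := by rw [norm_div, huz, div_self hz']
    set t : ℤ_[l] := ⟨u / z, ht.le⟩
    have key : ‖(A : ℤ_[l]) * t ^ 2 + (B : ℤ_[l])‖ = 1 := by
      refine (PadicInt.norm_le_one _).eq_of_not_lt fun hlt => h ?_
      have h0 : PadicInt.toZMod ((A : ℤ_[l]) * t ^ 2 + (B : ℤ_[l])) = 0 := by
        rwa [← RingHom.mem_ker, PadicInt.ker_toZMod, IsLocalRing.mem_maximalIdeal,
          PadicInt.mem_nonunits]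
      simp only [map_add, map_mul, map_pow, map_intCast] at h0
      refine ⟨A * PadicInt.toZMod t, ?_⟩
      push_cast
      linear_combination (-(A : ZMod l)) * h0
    have key' : ‖(A : ℚ_[l]) * (u / z) ^ 2 + B‖ = 1 := by
      rw [← key, PadicInt.norm_def]
      push_cast
      rfl
    have : (A : ℚ_[l]) * u ^ 2 + B * z ^ 2 = (A * (u / z) ^ 2 + B) * z ^ 2 := by
      field_simp
    rw [this, norm_mul, key', one_mul, norm_pow]
  · have hne : ‖(A : ℚ_[l]) * u ^ 2‖ ≠ ‖(B : ℚ_[l]) * z ^ 2‖ := by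
      rw [norm_mul, norm_mul, norm_intCast_eq_one_of_zmod_ne_zero hA,
      norm_intCast_eq_one_of_zmod_ne_zero hB, one_mul, one_mul, norm_pow, norm_pow]
      exact fun h => huz ((pow_left_inj₀ (norm_nonneg _) (norm_nonneg _) two_ne_zero).1 h)
    rw [Padic.add_eq_max_of_ne hne, norm_mul, norm_mul, norm_intCast_eq_one_of_zmod_ne_zero hA,
      norm_intCast_eq_one_of_zmod_ne_zero hB, one_mul, one_mul,
      norm_pow, norm_pow]
    rcases le_total ‖u‖ ‖z‖ with h | h
    · rw [max_eq_right h, max_eq_right (by gcongr)]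
    · rw [max_eq_left h, max_eq_left (by gcongr)]

theorem cd'Points_of_sq {K : Type} [Field K] {p q D d l e E : ℤ} (hd : d = l * e) (hD : D = l * E)
    (he : (e : K) ≠ 0) {s : K} (hs : s ^ 2 = (-(p * e * E) : ℤ)) : Cd'Points K p q D d := by
  refine ⟨s / e, 1, 0, fun h => one_ne_zero h.2, ?_⟩
  have h : (e : K) * (s / e) ^ 2 + p * E = 0 := by
    push_cast at hs
    field_simp
    rw [hs]
    ring
  subst hd hD
  push_cast
  linear_combination (-(l : K) ^ 2 * (e * ((s : K) / e) ^ 2 + q * E)) * h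

theorem cd'Points_comm {K : Type} [Field K] {p q D d : ℤ} :
    Cd'Points K p q D d ↔ Cd'Points K q p D d := by
  simp only [Cd'Points, add_comm (p : K), mul_comm (p : K)]

theorem not_cd'Points_of_not_isSquare {l : ℕ} [Fact l.Prime] {p q D d e E : ℤ}
    (hd : d = l * e) (hD : D = l * E) (he : (e : ZMod l) ≠ 0)
    (hpE : ((p * E : ℤ) : ZMod l) ≠ 0) (hqE : ((q * E : ℤ) : ZMod l) ≠ 0)
    (hp : ¬ IsSquare ((-(e * (p * E)) : ℤ) : ZMod l))
    (hq : ¬ IsSquare ((-(e * (q * E)) : ℤ) : ZMod l)) :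
    ¬ Cd'Points ℚ_[l] p q D d := by
  rintro ⟨u, z, w, huz, h⟩
  have hl : (l : ℚ_[l]) ≠ 0 := Nat.cast_ne_zero.2 (Fact.out : l.Prime).ne_zero
  have h' : (e : ℚ_[l]) * w ^ 2 =
      l * ((e * u ^ 2 + (p * E : ℤ) * z ^ 2) * (e * u ^ 2 + (q * E : ℤ) * z ^ 2)) := by
    refine mul_left_cancel₀ hl ?_
    subst hd hD
    push_cast at h ⊢
    linear_combination h
  obtain ⟨x, hx, hM⟩ : ∃ x : ℚ_[l], x ≠ 0 ∧ max ‖u‖ ‖z‖ = ‖x‖ := by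
    rcases max_cases ‖u‖ ‖z‖ with ⟨hm, hle⟩ | ⟨hm, hlt⟩
    · refine ⟨u, fun hu => huz ⟨hu, ?_⟩, hm⟩
      simpa [hu] using hle
    · exact ⟨z, norm_pos_iff.1 ((norm_nonneg u).trans_lt hlt), hm⟩
  have hnorm := congrArg norm h'
  rw [norm_mul, norm_mul, norm_mul, norm_binary_form he hpE hp, norm_binary_form he hqE hq, hM,
    norm_intCast_eq_one_of_zmod_ne_zero he, one_mul, ← norm_pow, ← norm_mul, ← norm_mul] at hnorm
  have hne : (l : ℚ_[l]) * (x ^ 2 * x ^ 2) ≠ 0 := by positivity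
  have hw : w ^ 2 ≠ 0 := norm_ne_zero_iff.1 (hnorm ▸ norm_ne_zero_iff.2 hne)
  have hl1 : (1 : ℝ) < l := mod_cast (Fact.out : l.Prime).one_lt
  rw [Padic.norm_eq_zpow_neg_valuation hw, Padic.norm_eq_zpow_neg_valuation hne,
    zpow_right_inj₀ (by positivity) hl1.ne', Padic.valuation_mul hl (by positivity),
    Padic.valuation_mul (by positivity) (by positivity)] at hnorm
  simp only [Padic.valuation_pow, Padic.valuation_p] at hnorm
  push_cast at hnorm
  omega

theorem stmt19
    (m : ℕ) (hm : 1 ≤ m)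
    (p q : ℕ) (hp : p.Prime) (hq : q.Prime) (hpodd : Odd p) (hqodd : Odd q)
    (hpq : (q : ℤ) - (p : ℤ) = 2 ^ m)
    (D : ℤ) (hD0 : 0 < D) (hDsf : Squarefree D) (hDodd : Odd D)
    (hpD : ¬((p : ℤ) ∣ D)) (hqD : ¬((q : ℤ) ∣ D))
    (d : ℤ) (hd0 : d ≠ 0) (hdD : d ∣ (p : ℤ) * D) :
    ∀ l : ℕ, ∀ hl : l.Prime, (l : ℤ) ∣ D → (l : ℤ) ∣ d →
      (letI : Fact l.Prime := ⟨hl⟩;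
        (Cd'Points ℚ_[l] (p : ℤ) (q : ℤ) D d ↔
          (legendreSym l (-((p : ℤ) * d * D) / (l : ℤ) ^ 2) = 1 ∨
            legendreSym l (-((q : ℤ) * d * D) / (l : ℤ) ^ 2) = 1))) := by
  intro l hl hlD hld
  have : Fact l.Prime := ⟨hl⟩
  have hlp := Nat.prime_iff_prime_int.1 hl
  have hl0 : (l : ℤ) ^ 2 ≠ 0 := pow_ne_zero 2 hlp.ne_zero
  have not_dvd {r : ℕ} (hr : r.Prime) (hrD : ¬ (r : ℤ) ∣ D) : ¬ (l : ℤ) ∣ r := fun h => by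
    rw [Int.natCast_dvd_natCast, Nat.prime_dvd_prime_iff_eq hl hr] at h
    exact hrD (h ▸ hlD)
  have hlp' := not_dvd hp hpD
  have hlq' := not_dvd hq hqD
  have hl2 : l ≠ 2 := by
    rintro rfl
    exact Int.not_even_iff_odd.2 hDodd (even_iff_two_dvd.2 hlD)
  obtain ⟨E, hE⟩ := hlD
  obtain ⟨e, he⟩ := hld
  have hlE : ¬ (l : ℤ) ∣ E := fun h =>
    hlp.not_isUnit (hDsf l (hE ▸ mul_dvd_mul_left _ h))
  have hle : ¬ (l : ℤ) ∣ e := fun h => by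
    rw [he, hE, mul_left_comm] at hdD
    exact (hlp.dvd_or_dvd (h.trans (Int.dvd_of_mul_dvd_mul_left hlp.ne_zero hdD))).elim hlp' hlE
  have hquot (r : ℤ) : -(r * d * D) / (l : ℤ) ^ 2 = -(r * e * E) := by
    rw [he, hE]
    exact Int.ediv_eq_of_eq_mul_right hl0 (by ring)
  have he0 : (e : ℚ_[l]) ≠ 0 := Int.cast_ne_zero.2 fun h => hle (h ▸ dvd_zero _)
  rw [hquot, hquot]
  have ne_zero {r : ℤ} (hr : ¬ (l : ℤ) ∣ r) : (r : ZMod l) ≠ 0 :=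
    mt (ZMod.intCast_zmod_eq_zero_iff_dvd r l).1 hr
  have hrE {r : ℤ} (hr : ¬ (l : ℤ) ∣ r) : ((r * E : ℤ) : ZMod l) ≠ 0 :=
    ne_zero (hlp.not_dvd_mul hr hlE)
  have hsq {r : ℤ} (hr : ¬ (l : ℤ) ∣ r) :
      legendreSym l (-(r * e * E)) = 1 ↔ IsSquare ((-(e * (r * E)) : ℤ) : ZMod l) := by
    have h : -(r * e * E) = -(e * (r * E)) := by ring
    rw [h, legendreSym.eq_one_iff]
    rw [Int.cast_neg, Int.cast_mul]
    exact neg_ne_zero.2 (mul_ne_zero (ne_zero hle) (hrE hr))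
  constructor
  · intro h
    by_contra! hc
    rw [Ne, Ne, hsq hlp', hsq hlq'] at hc
    exact not_cd'Points_of_not_isSquare he hE (ne_zero hle) (hrE hlp') (hrE hlq') hc.1 hc.2 h
  · rintro (h | h) <;> obtain ⟨s, hs⟩ := exists_sq_eq_intCast_of_legendreSym hl2 h
    · exact cd'Points_of_sq he hE he0 hs
    · exact cd'Points_comm.1 (cd'Points_of_sq he hE he0 hs)
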